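/- arXiv:1506.05694 — 2 statements merged into one kernel-verified Lean document; each statement's English description precedes it below -/
import Mathlib

section
/- Let ρ : ℝ → [0,1] be a smooth, symmetric (ρ(−x) = ρ(x)), compactly supported function. Then there exists a constant C = C(ρ) such that for all real M₁, M₂ ≥ 1, all c₁, c₂ ∈ ℝ, and all ψ₁, ψ₂ ∈ ℝ: |∑_{(k₁,k₂) ∈ ℤ²} ρ((k₁ − c₁)/M₁) ρ((k₂ − c₂)/M₂) e(k₁ψ₁ + k₂ψ₂) e(√2 (k₁² + k₂²))| ≤ C √(M₁ M₂). -/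
/-- `e(θ) = e^{2πiθ}`. -/
noncomputable def eC (θ : ℝ) : ℂ := Complex.exp (2 * Real.pi * Complex.I * θ)

theorem eC_add (x y : ℝ) : eC (x + y) = eC x * eC y := by
  unfold eC
  rw [← Complex.exp_add]
  push_cast
  ring_nf

theorem norm_eC (x : ℝ) : ‖eC x‖ = 1 := by
  unfold eC
  rw [Complex.norm_exp]
  simp

theorem conj_eC (x : ℝ) : (starRingEnd ℂ) (eC x) = eC (-x) := by
  unfold eC
  rw [← Complex.exp_conj]
  simp [map_ofNat]

theorem eC_intCast (n : ℤ) : eC n = 1 := by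
  unfold eC
  rw [← Complex.exp_int_mul_two_pi_mul_I n]
  push_cast
  ring_nf

/-- The distance from `e(x)` to `1` is at least four times the distance from `x` to `ℤ`. -/
theorem four_mul_abs_sub_round_le_norm_eC_sub_one (x : ℝ) :
    4 * |x - round x| ≤ ‖eC x - 1‖ := by
  have h1 : eC x = eC (x - round x) := by
    conv_lhs => rw [← sub_add_cancel x (round x : ℝ), eC_add, eC_intCast, mul_one]
  have h2 : eC (x - round x)
      = Complex.exp (Complex.I * ((2 * Real.pi * (x - round x) : ℝ) : ℂ)) := by
    unfold eC
    push_cast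
    ring_nf
  have hd := abs_sub_round x
  rw [h1, h2, Complex.norm_exp_I_mul_ofReal_sub_one]
  set d := x - round x
  have hpi := Real.pi_pos
  have h3 : |Real.pi * d| ≤ Real.pi / 2 := by
    rw [abs_mul, abs_of_pos hpi]
    nlinarith
  have h4 := Real.mul_abs_le_abs_sin h3
  rw [abs_mul, abs_of_pos hpi] at h4
  have h5 : 2 / Real.pi * (Real.pi * |d|) = 2 * |d| := by field_simp
  rw [norm_mul, show 2 * Real.pi * d / 2 = Real.pi * d by ring, Real.norm_eq_abs,
    Real.norm_eq_abs, abs_two]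
  linarith

/-- Squaring out an exponential sum and grouping the terms by the difference of the indices. -/
theorem norm_tsum_sq_le_tsum_norm_tsum_shift (a : ℤ → ℂ) (ha : a.HasFiniteSupport) :
    ‖∑' k, a k‖ ^ 2 ≤ ∑' h : ℤ, ‖∑' l : ℤ, a (l + h) * (starRingEnd ℂ) (a l)‖ := by
  have hfin : (Function.support a).Finite := ha
  let e : ℤ × ℤ ≃ ℤ × ℤ :=
    { toFun := fun p => (p.2 + p.1, p.2)
      invFun := fun p => (p.1 - p.2, p.2)
      left_inv := fun p => by simp
      right_inv := fun p => by simp }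
  let F : ℤ × ℤ → ℂ := fun p => a p.1 * (starRingEnd ℂ) (a p.2)
  have hF : F.HasFiniteSupport := by
    refine (hfin.prod hfin).subset fun p hp => ?_
    simp only [F, Function.mem_support, ne_eq, mul_eq_zero, map_eq_zero, not_or] at hp
    exact ⟨hp.1, hp.2⟩
  have hFe : (F ∘ e).HasFiniteSupport :=
    (Set.Finite.preimage e.injective.injOn hF).subset fun p hp => hp
  have hsum : Summable (F ∘ e) := summable_of_hasFiniteSupport hFe
  have hS : (∑' k, a k) * (starRingEnd ℂ) (∑' k, a k)
      = ∑' h : ℤ, ∑' l : ℤ, a (l + h) * (starRingEnd ℂ) (a l) := by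
    have hconj : (starRingEnd ℂ) (∑' k, a k) = ∑' k, (starRingEnd ℂ) (a k) := tsum_star
    have hac : (fun k => (starRingEnd ℂ) (a k)).HasFiniteSupport :=
      hfin.subset fun k hk => by simpa using hk
    rw [hconj, Summable.tsum_mul_tsum (summable_of_hasFiniteSupport ha)
      (summable_of_hasFiniteSupport hac) (summable_of_hasFiniteSupport hF), ← e.tsum_eq]
    exact hsum.tsum_prod
  have houter : (fun h : ℤ =>
      ‖∑' l : ℤ, a (l + h) * (starRingEnd ℂ) (a l)‖).HasFiniteSupport := by
    refine (Set.Finite.image Prod.fst hFe).subset fun h hh => ?_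
    by_contra hcon
    apply hh
    have : ∀ l, a (l + h) * (starRingEnd ℂ) (a l) = 0 := by
      intro l
      by_contra hl
      exact hcon ⟨(h, l), hl, rfl⟩
    simp [this]
  calc ‖∑' k, a k‖ ^ 2 = ‖(∑' k, a k) * (starRingEnd ℂ) (∑' k, a k)‖ := by
        rw [norm_mul, RCLike.norm_conj, sq]
    _ ≤ _ := by
        rw [hS]
        exact norm_tsum_le_tsum_norm (summable_of_hasFiniteSupport houter)

/-- Summation by parts, twice. -/
theorem norm_tsum_mul_eC_mul_sq_le (f : ℤ → ℝ) (hf : f.HasFiniteSupport) (θ : ℝ) :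
    ‖∑' l : ℤ, (f l : ℂ) * eC (θ * l)‖ * ‖eC θ - 1‖ ^ 2
      ≤ ∑' l : ℤ, |f (l + 1) + f (l - 1) - 2 * f l| := by
  have hfin : (Function.support f).Finite := hf
  have hs : ∀ m : ℤ, (fun l => f (l + m)).HasFiniteSupport := fun m =>
    (Set.Finite.preimage (add_left_injective m).injOn hfin).subset fun l hl => hl
  have hS : ∀ m : ℤ, Summable fun l : ℤ => (f (l + m) : ℂ) * eC (θ * l) := fun m =>
    summable_of_hasFiniteSupport <| (hs m).subset fun l hl => by
      intro h0
      apply hl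
      simp only at h0
      simp [h0]
  set S := ∑' l : ℤ, (f l : ℂ) * eC (θ * l) with hSdef
  have hz : eC (-θ) * eC θ = 1 := by
    rw [← eC_add, neg_add_cancel]
    simpa using eC_intCast 0
  have hshift : ∀ m : ℤ, ∑' l : ℤ, (f (l + m) : ℂ) * eC (θ * l) = eC (-(θ * m)) * S := by
    intro m
    rw [hSdef, ← tsum_mul_left, ← (Equiv.addRight m).tsum_eq fun l : ℤ =>
      eC (-(θ * m)) * ((f l : ℂ) * eC (θ * l))]
    refine tsum_congr fun l => ?_
    simp only [Equiv.coe_addRight]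
    rw [show θ * l = -(θ * m) + θ * ((l + m : ℤ) : ℝ) by push_cast; ring, eC_add]
    ring
  have h1 := hshift 1
  have h2 := hshift (-1)
  simp only [Int.cast_one, mul_one, Int.cast_neg, mul_neg, neg_neg] at h1 h2
  have hD : ∑' l : ℤ, ((f (l + 1) + f (l - 1) - 2 * f l : ℝ) : ℂ) * eC (θ * l)
      = eC (-θ) * (eC θ - 1) ^ 2 * S := by
    have hS0 : Summable fun l : ℤ => (f l : ℂ) * eC (θ * l) := by simpa using hS 0
    have : ∀ l : ℤ, ((f (l + 1) + f (l - 1) - 2 * f l : ℝ) : ℂ) * eC (θ * l)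
        = ((f (l + 1) : ℂ) * eC (θ * l) + (f (l + -1) : ℂ) * eC (θ * l))
          - 2 * ((f l : ℂ) * eC (θ * l)) := by
      intro l
      rw [sub_eq_add_neg l 1]
      push_cast
      ring
    rw [tsum_congr this, Summable.tsum_sub ((hS 1).add (hS (-1))) (hS0.mul_left 2),
      Summable.tsum_add (hS 1) (hS (-1)), h1, h2, tsum_mul_left, ← hSdef]
    linear_combination (2 * S - eC θ * S) * hz
  have hnorm : ∀ l : ℤ, ‖((f (l + 1) + f (l - 1) - 2 * f l : ℝ) : ℂ) * eC (θ * l)‖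
      = |f (l + 1) + f (l - 1) - 2 * f l| := fun l => by
    rw [norm_mul, norm_eC, mul_one, Complex.norm_real, Real.norm_eq_abs]
  have hD2 : Summable fun l : ℤ => f (l + 1) + f (l - 1) - 2 * f l :=
    ((summable_of_hasFiniteSupport (hs 1)).add
      (summable_of_hasFiniteSupport (hs (-1)))).sub
      ((summable_of_hasFiniteSupport hf).mul_left 2)
  calc ‖S‖ * ‖eC θ - 1‖ ^ 2 = ‖eC (-θ) * (eC θ - 1) ^ 2 * S‖ := by
        rw [norm_mul, norm_mul, norm_eC, norm_pow]
        ring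
    _ ≤ ∑' l : ℤ, ‖((f (l + 1) + f (l - 1) - 2 * f l : ℝ) : ℂ) * eC (θ * l)‖ := by
        rw [← hD]
        refine norm_tsum_le_tsum_norm ?_
        simp only [hnorm]
        exact hD2.abs
    _ = _ := tsum_congr hnorm

theorem card_Icc_ceil_floor_le (c r : ℝ) (hr : 0 ≤ r) :
    ((Finset.Icc ⌈c - r⌉ ⌊c + r⌋).card : ℝ) ≤ 2 * r + 1 := by
  rw [Int.card_Icc]
  have h1 := Int.le_ceil (c - r)
  have h2 := Int.floor_le (c + r)
  rcases le_total 0 (⌊c + r⌋ + 1 - ⌈c - r⌉) with h | h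
  · have : (((⌊c + r⌋ + 1 - ⌈c - r⌉).toNat : ℤ) : ℝ) = ((⌊c + r⌋ + 1 - ⌈c - r⌉ : ℤ) : ℝ) := by
      rw [Int.toNat_of_nonneg h]
    rw [Int.cast_natCast] at this
    rw [this]
    push_cast
    linarith
  · rw [Int.toNat_of_nonpos h]
    push_cast
    linarith

/-- A sum of terms of size at most `b` supported in an interval of radius `r`. -/
theorem tsum_norm_le_of_support_subset {E : Type*} [NormedAddCommGroup E] (g : ℤ → E)
    (c r b : ℝ) (hr : 0 ≤ r) (hb : ∀ l, ‖g l‖ ≤ b) (hg : ∀ l : ℤ, r < |(l : ℝ) - c| → g l = 0) :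
    ∑' l, ‖g l‖ ≤ (2 * r + 1) * b := by
  rw [tsum_eq_sum (s := Finset.Icc ⌈c - r⌉ ⌊c + r⌋)]
  · calc ∑ l ∈ Finset.Icc ⌈c - r⌉ ⌊c + r⌋, ‖g l‖
        ≤ (Finset.Icc ⌈c - r⌉ ⌊c + r⌋).card • b := Finset.sum_le_card_nsmul _ _ _ fun l _ => hb l
      _ ≤ (2 * r + 1) * b := by
        rw [nsmul_eq_mul]
        exact mul_le_mul_of_nonneg_right (card_Icc_ceil_floor_le c r hr)
          ((norm_nonneg _).trans (hb 0))
  · intro l hl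
    rw [hg l, norm_zero]
    by_contra! hcon
    rw [abs_le] at hcon
    exact hl (Finset.mem_Icc.2 ⟨Int.ceil_le.2 (by linarith), Int.le_floor.2 (by linarith)⟩)

/-- `2√2` is badly approximable. -/
theorem one_le_mul_abs_two_sqrt_two_mul_sub (h n : ℤ) (hh : h ≠ 0) :
    1 ≤ 7 * |(h : ℝ)| * |2 * √2 * h - n| := by
  have hh1 : (1 : ℝ) ≤ |(h : ℝ)| := by exact_mod_cast Int.one_le_abs hh
  have hsq : √2 ^ 2 = (2 : ℝ) := Real.sq_sqrt (by norm_num)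
  have hs0 : 0 ≤ √2 := Real.sqrt_nonneg 2
  have hs : √2 ≤ 1.5 := by
    rw [Real.sqrt_le_left (by norm_num)]
    norm_num
  have hne : 8 * h ^ 2 - n ^ 2 ≠ 0 := by
    intro h0
    have h0' : (8 : ℝ) * h ^ 2 - n ^ 2 = 0 := by exact_mod_cast h0
    have hprod : (2 * √2 * h - n) * (2 * √2 * h + n) = 0 := by
      linear_combination h0' + 4 * (h : ℝ) ^ 2 * hsq
    have hhr : (h : ℝ) ≠ 0 := by exact_mod_cast hh
    rcases mul_eq_zero.1 hprod with h1 | h1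
    · refine irrational_sqrt_two ⟨n / (2 * h), ?_⟩
      push_cast
      field_simp
      linarith
    · refine irrational_sqrt_two ⟨-n / (2 * h), ?_⟩
      push_cast
      field_simp
      linarith
  have hprod : 1 ≤ |2 * √2 * h - n| * |2 * √2 * h + n| := by
    have h1 : (2 * √2 * h - n) * (2 * √2 * h + n) = ((8 * h ^ 2 - n ^ 2 : ℤ) : ℝ) := by
      push_cast
      linear_combination 4 * (h : ℝ) ^ 2 * hsq
    rw [← abs_mul, h1]
    exact_mod_cast Int.one_le_abs hne
  rcases le_total |2 * √2 * h - n| (1 / 7) with hx | hx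
  · have habs : |2 * √2 * (h : ℝ)| ≤ 3 * |(h : ℝ)| := by
      rw [abs_mul, abs_of_nonneg (by positivity)]
      nlinarith
    have h2 : |2 * √2 * h + n| ≤ 7 * |(h : ℝ)| := by
      have : 2 * √2 * (h : ℝ) + n = 2 * (2 * √2 * h) - (2 * √2 * h - n) := by ring
      rw [this]
      refine (abs_sub _ _).trans ?_
      rw [abs_mul, abs_two]
      linarith
    nlinarith [abs_nonneg (2 * √2 * (h : ℝ) - n)]
  · nlinarith

theorem summable_one_div_one_add_int_sq : Summable fun j : ℤ => 1 / (1 + (j : ℝ) ^ 2) := by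
  have h : Summable fun j : ℤ => 1 / (j : ℝ) ^ 2 := Real.summable_one_div_int_pow.2 (by norm_num)
  refine Summable.of_norm_bounded_eventually h ?_
  have : {j : ℤ | j ≠ 0} ∈ Filter.cofinite :=
    (Set.finite_singleton 0).compl_mem_cofinite
  filter_upwards [this] with j hj
  have hj' : (0 : ℝ) < (j : ℝ) ^ 2 := by positivity
  rw [Real.norm_eq_abs, abs_of_nonneg (by positivity)]
  exact one_div_le_one_div_of_le hj' (by linarith)

/-- The fractional parts of `2√2 h`, `|h| ≤ N`, are spaced by a multiple of `1 / N`, so a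
function decaying quadratically in them has a bounded sum. -/
theorem tsum_le_of_mul_sq_sub_round_le (g : ℤ → ℝ) (N P Q : ℝ) (hN : 0 < N) (hg0 : ∀ h, 0 ≤ g h)
    (hgN : ∀ h : ℤ, N < |(h : ℝ)| → g h = 0) (hP : ∀ h, g h ≤ P)
    (hQ : ∀ h : ℤ, g h * (2 * √2 * h - round (2 * √2 * h)) ^ 2 ≤ Q) :
    ∑' h, g h ≤ (3 * P + 392 * N ^ 2 * Q) * ∑' j : ℤ, 1 / (1 + (j : ℝ) ^ 2) := by
  set d : ℤ → ℝ := fun h => 2 * √2 * h - round (2 * √2 * h) with hd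
  set φ : ℤ → ℤ := fun h => ⌊14 * N * d h⌋ with hφ
  set H : Finset ℤ := Finset.Icc ⌈-N⌉ ⌊N⌋ with hH
  have hmem : ∀ h : ℤ, h ∈ H ↔ |(h : ℝ)| ≤ N := by
    intro h
    rw [hH, Finset.mem_Icc, Int.ceil_le, Int.le_floor, abs_le]
  have hinj : Set.InjOn φ H := by
    intro x hx y hy hxy
    rw [Finset.mem_coe, hmem] at hx hy
    by_contra hne
    have h1 := one_le_mul_abs_two_sqrt_two_mul_sub (x - y)
      (round (2 * √2 * (x : ℝ)) - round (2 * √2 * (y : ℝ))) (sub_ne_zero.2 hne)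
    have h2 : 2 * √2 * ((x - y : ℤ) : ℝ)
        - ((round (2 * √2 * (x : ℝ)) - round (2 * √2 * (y : ℝ)) : ℤ) : ℝ) = d x - d y := by
      simp only [hd]
      push_cast
      ring
    rw [h2] at h1
    have h3 := Int.abs_sub_lt_one_of_floor_eq_floor hxy
    have h4 : |((x - y : ℤ) : ℝ)| ≤ 2 * N := by
      push_cast
      exact (abs_sub _ _).trans (by linarith)
    rw [← mul_sub, abs_mul, abs_of_pos (by positivity)] at h3
    nlinarith [abs_nonneg (d x - d y)]
  have hbound : ∀ h, g h ≤ (3 * P + 392 * N ^ 2 * Q) * (1 / (1 + (φ h : ℝ) ^ 2)) := by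
    intro h
    rw [mul_one_div, le_div_iff₀ (by positivity)]
    have h1 := Int.floor_le (14 * N * d h)
    have h2 := Int.lt_floor_add_one (14 * N * d h)
    have h3 : (φ h : ℝ) ^ 2 ≤ 2 * (14 * N * d h) ^ 2 + 2 := by
      set y := 14 * N * d h
      change ((⌊y⌋ : ℤ) : ℝ) ^ 2 ≤ _
      nlinarith [sq_nonneg (2 * y - ⌊y⌋)]
    have h4 := mul_le_mul_of_nonneg_left h3 (hg0 h)
    have h5 := mul_le_mul_of_nonneg_left (hQ h) (show 0 ≤ 392 * N ^ 2 by positivity)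
    have h6 := hP h
    change 392 * N ^ 2 * (g h * (d h) ^ 2) ≤ _ at h5
    nlinarith
  have hP0 : 0 ≤ P := (hg0 0).trans (hP 0)
  have hQ0 : 0 ≤ Q := (mul_nonneg (hg0 0) (sq_nonneg _)).trans (hQ 0)
  rw [tsum_eq_sum (s := H) fun h hh => hgN h (by rwa [hmem, not_le] at hh)]
  calc ∑ h ∈ H, g h
      ≤ ∑ h ∈ H, (3 * P + 392 * N ^ 2 * Q) * (1 / (1 + (φ h : ℝ) ^ 2)) :=
        Finset.sum_le_sum fun h _ => hbound h
    _ = (3 * P + 392 * N ^ 2 * Q) * ∑ j ∈ H.image φ, 1 / (1 + (j : ℝ) ^ 2) := by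
        rw [← Finset.mul_sum, Finset.sum_image hinj]
    _ ≤ _ := by
        refine mul_le_mul_of_nonneg_left ?_ (by positivity)
        exact summable_one_div_one_add_int_sq.sum_le_tsum _ fun j _ => by positivity

theorem abs_second_difference_le {ρ : ℝ → ℝ} (hρ : Differentiable ℝ ρ) {K : ℝ} (hK : 0 ≤ K)
    (hlip : ∀ x y, |deriv ρ x - deriv ρ y| ≤ K * |x - y|) (x d : ℝ) (hd : 0 ≤ d) :
    |ρ (x + d) + ρ (x - d) - 2 * ρ x| ≤ 2 * K * d ^ 2 := by
  have hderiv : ∀ t : ℝ, HasDerivAt (fun t => ρ (x + t) + ρ (x - t))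
      (deriv ρ (x + t) - deriv ρ (x - t)) t := by
    intro t
    have h1 := (hρ (x + t)).hasDerivAt.comp_const_add x t
    have h2 := (hρ (x - t)).hasDerivAt.comp_const_sub x t
    exact (h1.add h2).congr_deriv (sub_eq_add_neg _ _).symm
  have hbound : ∀ t ∈ Set.Icc 0 d, ‖deriv ρ (x + t) - deriv ρ (x - t)‖ ≤ 2 * K * d := by
    intro t ht
    refine (hlip _ _).trans ?_
    rw [show x + t - (x - t) = 2 * t by ring, abs_of_nonneg (by linarith [ht.1])]
    nlinarith [ht.2]
  have := (convex_Icc (0 : ℝ) d).norm_image_sub_le_of_norm_hasDerivWithin_le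
    (fun t _ => (hderiv t).hasDerivWithinAt) hbound (Set.left_mem_Icc.2 hd) (Set.right_mem_Icc.2 hd)
  simp only [add_zero, sub_zero, Real.norm_eq_abs, abs_of_nonneg hd] at this
  convert this using 1
  · congr 1
    ring
  · ring

/-- A discrete Leibniz rule for second differences. -/
theorem abs_second_difference_mul_le {u u₁ u₂ v v₁ v₂ D E : ℝ} (hu : |u| ≤ 1) (hv : |v| ≤ 1)
    (hu₁ : |u₁ - u| ≤ D) (hu₂ : |u₂ - u| ≤ D) (hv₁ : |v₁ - v| ≤ D) (hv₂ : |v₂ - v| ≤ D)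
    (huE : |u₁ + u₂ - 2 * u| ≤ E) (hvE : |v₁ + v₂ - 2 * v| ≤ E) :
    |u₁ * v₁ + u₂ * v₂ - 2 * (u * v)| ≤ 2 * E + 2 * D ^ 2 := by
  have hD : 0 ≤ D := (abs_nonneg _).trans hu₁
  have hE : 0 ≤ E := (abs_nonneg _).trans huE
  have key : ∀ {a b A B : ℝ}, |a| ≤ A → |b| ≤ B → 0 ≤ A → |a * b| ≤ A * B :=
    fun ha hb hA => by
      rw [abs_mul]
      exact mul_le_mul ha hb (abs_nonneg _) hA
  have h1 := abs_le.1 (key hu hvE zero_le_one)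
  have h2 := abs_le.1 (key hv huE zero_le_one)
  have h3 := abs_le.1 (key hu₁ hv₁ hD)
  have h4 := abs_le.1 (key hu₂ hv₂ hD)
  rw [abs_le]
  constructor <;> linarith [h1.1, h1.2, h2.1, h2.2, h3.1, h3.2, h4.1, h4.2]

theorem eq_zero_of_mul_lt_abs_sub {ρ : ℝ → ℝ} {R M : ℝ} (hM : 0 < M)
    (hR : ∀ x, R < |x| → ρ x = 0) (x : ℝ) (hx : R * M < |x|) : ρ (x / M) = 0 :=
  hR _ (by rwa [abs_div, abs_of_pos hM, lt_div_iff₀ hM])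

theorem hasFiniteSupport_of_mul_lt_abs_sub {E : Type*} [Zero E] (g : ℤ → E) (c r : ℝ)
    (hg : ∀ l : ℤ, r < |(l : ℝ) - c| → g l = 0) : g.HasFiniteSupport := by
  refine (Set.finite_Icc ⌈c - r⌉ ⌊c + r⌋).subset fun l hl => ?_
  have h : |(l : ℝ) - c| ≤ r := not_lt.1 fun h => hl (hg l h)
  rw [abs_le] at h
  exact ⟨Int.ceil_le.2 (by linarith), Int.le_floor.2 (by linarith)⟩

/-- The one-dimensional mollified quadratic sum exhibits square-root cancellation. -/
theorem norm_tsum_quadratic_sq_le {ρ : ℝ → ℝ} {K L R : ℝ} (hR1 : 1 ≤ R)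
    (hρ1 : ∀ x, |ρ x| ≤ 1) (hL : ∀ x y, |ρ x - ρ y| ≤ L * |x - y|)
    (hK : ∀ x d, 0 ≤ d → |ρ (x + d) + ρ (x - d) - 2 * ρ x| ≤ K * d ^ 2)
    (hR : ∀ x, R < |x| → ρ x = 0) (M c ψ : ℝ) (hM : 1 ≤ M) :
    ‖∑' k : ℤ, (ρ ((k - c) / M) : ℂ) * eC (k * ψ + √2 * (k : ℝ) ^ 2)‖ ^ 2
      ≤ (2 * R + 3) * (3 + 98 * R ^ 2 * (2 * K + 2 * L ^ 2))
        * (∑' j : ℤ, 1 / (1 + (j : ℝ) ^ 2)) * M := by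
  have hM0 : 0 < M := by linarith
  have hRM : 1 ≤ R * M := one_le_mul_of_one_le_of_one_le hR1 hM
  set w : ℤ → ℝ := fun l => ρ ((l - c) / M) with hw
  have hw0 : ∀ l : ℤ, R * M < |(l : ℝ) - c| → w l = 0 := fun l hl =>
    eq_zero_of_mul_lt_abs_sub hM0 hR _ hl
  have hstep : ∀ l : ℤ, |w (l + 1) - w l| ≤ L / M ∧ |w (l - 1) - w l| ≤ L / M ∧
      |w (l + 1) + w (l - 1) - 2 * w l| ≤ K / M ^ 2 := by
    intro l
    have e1 : (((l + 1 : ℤ) : ℝ) - c) / M = (l - c) / M + 1 / M := by push_cast; ring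
    have e2 : (((l - 1 : ℤ) : ℝ) - c) / M = (l - c) / M - 1 / M := by push_cast; ring
    simp only [hw, e1, e2]
    have hpos : 0 ≤ 1 / M := by positivity
    refine ⟨?_, ?_, ?_⟩
    · refine (hL _ _).trans_eq ?_
      rw [add_sub_cancel_left, abs_of_nonneg hpos, mul_one_div]
    · refine (hL _ _).trans_eq ?_
      rw [sub_sub_cancel_left, abs_neg, abs_of_nonneg hpos, mul_one_div]
    · refine (hK _ _ hpos).trans_eq ?_
      rw [one_div, inv_pow, div_eq_mul_inv]
  have hw1 : ∀ l, |w l| ≤ 1 := fun l => hρ1 _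
  set f : ℤ → ℤ → ℝ := fun h l => w (l + h) * w l with hf
  have hf0 : ∀ h l : ℤ, R * M < |(l : ℝ) - c| → f h l = 0 := fun h l hl => by
    simp only [hf, hw0 l hl, mul_zero]
  have hfh : ∀ h l : ℤ, 2 * R * M < |(h : ℝ)| → f h l = 0 := by
    intro h l hh
    by_cases hl : R * M < |(l : ℝ) - c|
    · exact hf0 h l hl
    · have : R * M < |((l + h : ℤ) : ℝ) - c| := by
        have h1 : |(h : ℝ)| ≤ |((l + h : ℤ) : ℝ) - c| + |(l : ℝ) - c| := by
          rw [show (h : ℝ) = (((l + h : ℤ) : ℝ) - c) - ((l : ℝ) - c) by push_cast; ring]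
          exact abs_sub _ _
        linarith
      simp only [hf, hw0 _ this, zero_mul]
  set g : ℤ → ℝ := fun h => ‖∑' l : ℤ, (f h l : ℂ) * eC (2 * √2 * h * l)‖ with hg
  have hgP : ∀ h, g h ≤ (2 * R + 3) * M := by
    intro h
    have hterm0 : ∀ l : ℤ, R * M < |(l : ℝ) - c| → (f h l : ℂ) * eC (2 * √2 * h * l) = 0 :=
      fun l hl => by simp [hf0 h l hl]
    have hsum : Summable fun l : ℤ => (f h l : ℂ) * eC (2 * √2 * h * l) :=
      summable_of_hasFiniteSupport (hasFiniteSupport_of_mul_lt_abs_sub _ c _ hterm0)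
    refine (norm_tsum_le_tsum_norm hsum.norm).trans ?_
    refine (tsum_norm_le_of_support_subset _ c (R * M) 1 (by linarith) (fun l => ?_)
      hterm0).trans (by linarith)
    rw [norm_mul, norm_eC, mul_one, Complex.norm_real, Real.norm_eq_abs, abs_mul]
    exact mul_le_one₀ (hw1 _) (abs_nonneg _) (hw1 _)
  have hgQ : ∀ h : ℤ, g h * (2 * √2 * h - round (2 * √2 * h)) ^ 2
      ≤ (2 * R + 3) * (2 * K + 2 * L ^ 2) / (16 * M) := by
    intro h
    have h1 := norm_tsum_mul_eC_mul_sq_le (f h)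
      (hasFiniteSupport_of_mul_lt_abs_sub _ c _ (hf0 h)) (2 * √2 * h)
    have h2 := four_mul_abs_sub_round_le_norm_eC_sub_one (2 * √2 * h)
    have h3 : 16 * (2 * √2 * h - round (2 * √2 * h)) ^ 2 ≤ ‖eC (2 * √2 * h) - 1‖ ^ 2 := by
      have := pow_le_pow_left₀ (by positivity) h2 2
      rw [mul_pow, sq_abs] at this
      linarith
    have h4 : ∑' l : ℤ, |f h (l + 1) + f h (l - 1) - 2 * f h l|
        ≤ (2 * (R * M + 1) + 1) * (2 * (K / M ^ 2) + 2 * (L / M) ^ 2) := by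
      refine tsum_norm_le_of_support_subset
        (fun l : ℤ => f h (l + 1) + f h (l - 1) - 2 * f h l) c _ _ (by linarith)
        (fun l => ?_) fun l hl => ?_
      · obtain ⟨a1, a2, a3⟩ := hstep l
        obtain ⟨b1, b2, b3⟩ := hstep (l + h)
        simp only [hf, Real.norm_eq_abs, add_right_comm l 1 h, sub_add_eq_add_sub l 1 h]
        exact abs_second_difference_mul_le (hw1 _) (hw1 _) b1 b2 a1 a2 b3 a3
      · have t1 : R * M < |((l + 1 : ℤ) : ℝ) - c| := by
          have := abs_sub_abs_le_abs_sub ((l : ℝ) - c) (-1)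
          rw [abs_neg, abs_one] at this
          rw [show ((l + 1 : ℤ) : ℝ) - c = (l : ℝ) - c - -1 by push_cast; ring]
          linarith
        have t2 : R * M < |((l - 1 : ℤ) : ℝ) - c| := by
          have := abs_sub_abs_le_abs_sub ((l : ℝ) - c) 1
          rw [abs_one] at this
          rw [show ((l - 1 : ℤ) : ℝ) - c = (l : ℝ) - c - 1 by push_cast; ring]
          linarith
        simp only [hf0 h _ t1, hf0 h _ t2, hf0 h l (by linarith)]
        ring
    have hKL : 0 ≤ 2 * K + 2 * L ^ 2 := by
      have := (abs_nonneg _).trans (hK 0 1 zero_le_one)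
      nlinarith [sq_nonneg L]
    have h5 : (2 * (R * M + 1) + 1) * (2 * (K / M ^ 2) + 2 * (L / M) ^ 2)
        ≤ (2 * R + 3) * (2 * K + 2 * L ^ 2) / M := by
      have : (2 * (R * M + 1) + 1) * (2 * (K / M ^ 2) + 2 * (L / M) ^ 2)
          = (2 * (R * M + 1) + 1) * (2 * K + 2 * L ^ 2) / M / M := by
        field_simp
      rw [this]
      refine div_le_div_of_nonneg_right ?_ hM0.le
      rw [div_le_iff₀ hM0]
      nlinarith [mul_nonneg hKL (sub_nonneg.2 hM)]
    have h6 := mul_le_mul_of_nonneg_left h3 (norm_nonneg (∑' l : ℤ, (f h l : ℂ) *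
      eC (2 * √2 * h * l)))
    change g h * _ ≤ g h * _ at h6
    change g h * _ ≤ _ at h1
    have h7 : (2 * R + 3) * (2 * K + 2 * L ^ 2) / (16 * M)
        = (2 * R + 3) * (2 * K + 2 * L ^ 2) / M / 16 := by
      field_simp
    rw [h7, le_div_iff₀ (by norm_num)]
    linarith
  have hgN : ∀ h : ℤ, 2 * R * M < |(h : ℝ)| → g h = 0 := fun h hh => by
    simp only [hg, hfh h _ hh, Complex.ofReal_zero, zero_mul, tsum_zero, norm_zero]
  have hsum := tsum_le_of_mul_sq_sub_round_le g (2 * R * M) _ _ (by positivity)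
    (fun h => norm_nonneg _) hgN hgP hgQ
  set a : ℤ → ℂ := fun k => (ρ ((k - c) / M) : ℂ) * eC (k * ψ + √2 * (k : ℝ) ^ 2) with ha
  have haf : a.HasFiniteSupport := hasFiniteSupport_of_mul_lt_abs_sub _ c (R * M) fun l hl => by
    have : ρ ((l - c) / M) = 0 := hw0 l hl
    simp [ha, this]
  have hshift : ∀ h : ℤ, ‖∑' l : ℤ, a (l + h) * (starRingEnd ℂ) (a l)‖ = g h := by
    intro h
    have : ∀ l : ℤ, a (l + h) * (starRingEnd ℂ) (a l)
        = eC (h * ψ + √2 * (h : ℝ) ^ 2) * ((f h l : ℂ) * eC (2 * √2 * h * l)) := by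
      intro l
      simp only [ha, hf, hw, map_mul, Complex.conj_ofReal, conj_eC, Complex.ofReal_mul]
      have he : eC (((l + h : ℤ) : ℝ) * ψ + √2 * ((l + h : ℤ) : ℝ) ^ 2)
          * eC (-(l * ψ + √2 * (l : ℝ) ^ 2))
          = eC (h * ψ + √2 * (h : ℝ) ^ 2) * eC (2 * √2 * h * l) := by
        rw [← eC_add, ← eC_add]
        congr 1
        push_cast
        ring
      linear_combination ((ρ ((((l + h : ℤ) : ℝ) - c) / M) : ℂ) * (ρ ((l - c) / M) : ℂ)) * he
    rw [tsum_congr this, tsum_mul_left, norm_mul, norm_eC, one_mul]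
  have hvdc := norm_tsum_sq_le_tsum_norm_tsum_shift a haf
  rw [tsum_congr hshift] at hvdc
  refine (hvdc.trans hsum).trans_eq ?_
  field_simp
  ring

/-- Lemma 4, estimate (3.16): for a smooth symmetric compactly supported bump
`ρ : ℝ → [0,1]` there is `C = C(ρ)` such that for all `M₁, M₂ ≥ 1`, all centers
`c₁, c₂` and all `ψ₁, ψ₂ ∈ ℝ`,
`|∑_{k ∈ ℤ²} ρ((k₁−c₁)/M₁) ρ((k₂−c₂)/M₂) e(k₁ψ₁+k₂ψ₂) e(√2(k₁²+k₂²))| ≤ C √(M₁M₂)`. -/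
theorem mollified_gauss_sum_bound (ρ : ℝ → ℝ) (hsmooth : ContDiff ℝ (⊤ : ℕ∞) ρ)
    (hsymm : ∀ x, ρ (-x) = ρ x) (hsupp : HasCompactSupport ρ)
    (hrange : ∀ x, ρ x ∈ Set.Icc (0 : ℝ) 1) :
    ∃ C : ℝ, ∀ M₁ M₂ : ℝ, 1 ≤ M₁ → 1 ≤ M₂ → ∀ c₁ c₂ ψ₁ ψ₂ : ℝ,
      ‖∑' k : ℤ × ℤ, (ρ ((k.1 - c₁) / M₁) * ρ ((k.2 - c₂) / M₂) : ℂ) *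
          eC (k.1 * ψ₁ + k.2 * ψ₂) *
          eC (Real.sqrt 2 * ((k.1 : ℝ) ^ 2 + (k.2 : ℝ) ^ 2))‖ ≤
        C * Real.sqrt (M₁ * M₂) := by
  obtain ⟨L, hL⟩ := hsmooth.lipschitzWith_of_hasCompactSupport hsupp (by simp)
  obtain ⟨K, hK⟩ := ContDiff.lipschitzWith_of_hasCompactSupport hsupp.deriv
    (hsmooth.iterate_deriv 1) (by simp)
  have hL' : ∀ x y, |ρ x - ρ y| ≤ L * |x - y| := fun x y => by
    simpa [Real.dist_eq] using hL.dist_le_mul x y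
  have hK' : ∀ x y, |deriv ρ x - deriv ρ y| ≤ K * |x - y| := fun x y => by
    simpa [Real.dist_eq] using hK.dist_le_mul x y
  have hK2 := abs_second_difference_le (hsmooth.differentiable (by simp)) K.2 hK'
  obtain ⟨R₀, hR₀⟩ := hsupp.isCompact.isBounded.subset_closedBall 0
  set R := max R₀ 1
  have hR : ∀ x, R < |x| → ρ x = 0 := by
    intro x hx
    by_contra hne
    have := hR₀ (subset_tsupport ρ hne)
    rw [mem_closedBall_zero_iff, Real.norm_eq_abs] at this
    exact absurd (this.trans (le_max_left R₀ 1)) (not_le.2 hx)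
  have hρ1 : ∀ x, |ρ x| ≤ 1 := fun x => by
    rw [abs_of_nonneg (hrange x).1]
    exact (hrange x).2
  obtain ⟨C, hone⟩ : ∃ C : ℝ, ∀ M c ψ : ℝ, 1 ≤ M →
      ‖∑' k : ℤ, (ρ ((k - c) / M) : ℂ) * eC (k * ψ + √2 * (k : ℝ) ^ 2)‖ ^ 2 ≤ C * M :=
    ⟨_, norm_tsum_quadratic_sq_le (le_max_right R₀ 1) hρ1 hL' hK2 hR⟩
  refine ⟨C, fun M₁ M₂ hM₁ hM₂ c₁ c₂ ψ₁ ψ₂ => ?_⟩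
  have hC : 0 ≤ C := by
    have := (sq_nonneg _).trans (hone 1 0 0 le_rfl)
    rwa [mul_one] at this
  have hfin : ∀ M c ψ : ℝ, 1 ≤ M → (fun k : ℤ =>
      (ρ ((k - c) / M) : ℂ) * eC (k * ψ + √2 * (k : ℝ) ^ 2)).HasFiniteSupport :=
    fun M c ψ hM => hasFiniteSupport_of_mul_lt_abs_sub _ c (R * M) fun l hl => by
      simp only [eq_zero_of_mul_lt_abs_sub (by linarith) hR _ hl, Complex.ofReal_zero, zero_mul]
  have hprod : ∀ k : ℤ × ℤ, (ρ ((k.1 - c₁) / M₁) * ρ ((k.2 - c₂) / M₂) : ℂ) *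
      eC (k.1 * ψ₁ + k.2 * ψ₂) * eC (√2 * ((k.1 : ℝ) ^ 2 + (k.2 : ℝ) ^ 2))
      = ((ρ ((k.1 - c₁) / M₁) : ℂ) * eC (k.1 * ψ₁ + √2 * (k.1 : ℝ) ^ 2))
        * ((ρ ((k.2 - c₂) / M₂) : ℂ) * eC (k.2 * ψ₂ + √2 * (k.2 : ℝ) ^ 2)) := by
    intro k
    rw [mul_add √2]
    simp only [eC_add]
    ring
  rw [tsum_congr hprod, ← tsum_mul_tsum_of_summable_norm
    (summable_of_hasFiniteSupport (hfin M₁ c₁ ψ₁ hM₁)).norm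
    (summable_of_hasFiniteSupport (hfin M₂ c₂ ψ₂ hM₂)).norm, norm_mul]
  refine (sq_le_sq₀ (by positivity) (by positivity)).1 ?_
  rw [mul_pow, mul_pow, Real.sq_sqrt (by positivity)]
  refine (mul_le_mul (hone M₁ c₁ ψ₁ hM₁) (hone M₂ c₂ ψ₂ hM₂) (sq_nonneg _)
    (by positivity)).trans_eq ?_
  ring
end

section
/- Let ρ : ℝ → [0,1] be a smooth, compactly supported function. Then there exists a constant C = C(ρ) such that for all real L' ≥ 1 and all β ∈ ℝ: |∑_{n ∈ ℤ} ρ(n/L') e(βn)| ≤ C/L' + C/(L'‖β‖² + 1/L'), where ‖β‖ is the distance from β to the nearest integer. -/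
/-- The distance from a real number to the nearest integer. -/
noncomputable def distNearestInt (y : ℝ) : ℝ := |y - round y|

theorem eC_add_eC_neg (x : ℝ) :
    eC x + eC (-x) = ((2 * Real.cos (2 * Real.pi * x) : ℝ) : ℂ) := by
  push_cast
  rw [Complex.two_cos]
  simp only [eC]
  congr 2 <;> push_cast <;> ring

theorem sixteen_mul_distNearestInt_sq_le (β : ℝ) :
    16 * distNearestInt β ^ 2 ≤ 2 - 2 * Real.cos (2 * Real.pi * β) := by
  have hd : |β - round β| ≤ 1 / 2 := abs_sub_round β
  have hcos : Real.cos (2 * Real.pi * β) = Real.cos (2 * Real.pi * (β - round β)) := by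
    rw [← Real.cos_sub_int_mul_two_pi _ (round β)]
    congr 1
    ring
  have hx : |2 * Real.pi * (β - round β)| ≤ Real.pi := by
    rw [abs_mul, abs_of_pos Real.two_pi_pos]
    nlinarith [Real.pi_pos]
  have h := Real.cos_le_one_sub_mul_cos_sq hx
  have he : 2 / Real.pi ^ 2 * (2 * Real.pi * (β - round β)) ^ 2 = 8 * (β - round β) ^ 2 := by
    field_simp
    ring
  rw [he] at h
  rw [distNearestInt, sq_abs, hcos]
  linarith

theorem summable_of_eq_zero_of_lt_abs {h : ℤ → ℂ} {N : ℕ}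
    (hN : ∀ n : ℤ, (N : ℤ) < |n| → h n = 0) :
    Summable h := by
  apply summable_of_ne_finset_zero (s := Finset.Icc (-(N : ℤ)) N)
  intro n hn
  apply hN
  rw [Finset.mem_Icc, ← abs_le] at hn
  exact not_le.mp hn

theorem norm_tsum_int_le_of_eq_zero_of_lt_abs {h : ℤ → ℂ} {N : ℕ} {M : ℝ}
    (hN : ∀ n : ℤ, (N : ℤ) < |n| → h n = 0) (hM : ∀ n, ‖h n‖ ≤ M) :
    ‖∑' n, h n‖ ≤ (2 * N + 1) * M := by
  rw [tsum_eq_sum (s := Finset.Icc (-(N : ℤ)) N)]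
  · refine (norm_sum_le_of_le _ fun n _ => hM n).trans_eq ?_
    have hc : (N + 1 - -(N : ℤ)).toNat = 2 * N + 1 := by omega
    rw [Finset.sum_const, Int.card_Icc, hc, nsmul_eq_mul]
    push_cast
    ring
  · intro n hn
    apply hN
    rw [Finset.mem_Icc, ← abs_le] at hn
    exact not_le.mp hn

theorem abs_second_difference_le_s7 {f : ℝ → ℝ} {K : NNReal} (hf : Differentiable ℝ f)
    (hK : LipschitzWith K (deriv f)) (x : ℝ) {h : ℝ} (hh : 0 ≤ h) :
    |2 * f x - f (x - h) - f (x + h)| ≤ 2 * K * h ^ 2 := by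
  have hder : ∀ t ∈ Set.Icc (0 : ℝ) h, HasDerivWithinAt (fun t => f (x + t) + f (x - t))
      (deriv f (x + t) - deriv f (x - t)) (Set.Icc 0 h) t := by
    intro t _
    have h1 := (hf (x + t)).hasDerivAt.comp_const_add x t
    have h2 := (hf (x - t)).hasDerivAt.comp_const_sub x t
    rw [sub_eq_add_neg]
    exact (h1.add h2).hasDerivWithinAt
  have hb : ∀ t ∈ Set.Ico (0 : ℝ) h, ‖deriv f (x + t) - deriv f (x - t)‖ ≤ 2 * K * h := by
    intro t ht
    have := hK.dist_le_mul (x + t) (x - t)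
    rw [dist_eq_norm, Real.dist_eq] at this
    have he : x + t - (x - t) = 2 * t := by ring
    rw [he, abs_of_nonneg (by linarith [ht.1])] at this
    nlinarith [ht.2, K.coe_nonneg]
  have := norm_image_sub_le_of_norm_deriv_le_segment' hder hb h (Set.right_mem_Icc.mpr hh)
  simp only [add_zero, sub_zero, Real.norm_eq_abs] at this
  rw [abs_sub_comm] at this
  convert this using 1
  · congr 1
    ring
  · ring

theorem two_sub_two_cos_mul_tsum {f : ℤ → ℂ} (β : ℝ) {N : ℕ}
    (hN : ∀ n : ℤ, (N : ℤ) < |n| → f n = 0) :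
    ((2 - 2 * Real.cos (2 * Real.pi * β) : ℝ) : ℂ) * ∑' n : ℤ, f n * eC (β * n) =
      ∑' n : ℤ, (2 * f n - f (n - 1) - f (n + 1)) * eC (β * n) := by
  have hs : Summable fun n : ℤ => f n * eC (β * n) :=
    summable_of_eq_zero_of_lt_abs fun n hn => by rw [hN n hn, zero_mul]
  have shift (k : ℤ) : HasSum (fun n : ℤ => f (n + k) * eC (β * n))
      (eC (-(β * k)) * ∑' n : ℤ, f n * eC (β * n)) := by
    have h := ((Equiv.addRight k).hasSum_iff.mpr hs.hasSum).mul_left (eC (-(β * k)))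
    suffices he : (fun n : ℤ => f (n + k) * eC (β * n)) = _ by rw [he]; exact h
    ext n
    simp only [Function.comp_apply, Equiv.coe_addRight]
    have he : β * (n : ℝ) = -(β * k) + β * ((n + k : ℤ) : ℝ) := by
      push_cast
      ring
    rw [he, eC_add]
    ring
  have h := ((hs.hasSum.mul_left 2).sub (shift (-1))).sub (shift 1)
  have hc := eC_add_eC_neg β
  convert h.tsum_eq.symm using 1
  · rw [Complex.ofReal_sub, ← hc]
    simp only [Int.cast_neg, Int.cast_one, mul_neg, mul_one, neg_neg]
    push_cast
    ring
  · congr 1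
    ext n
    rw [← sub_eq_add_neg]
    ring

/-- For a smooth compactly supported bump `ρ : ℝ → [0,1]` there is `C = C(ρ)` with
`|∑_{n ∈ ℤ} ρ(n/L') e(βn)| ≤ C/L' + C/(L'‖β‖² + 1/L')` for all `L' ≥ 1`, `β ∈ ℝ`. -/
theorem mollified_exponential_sum_bound (ρ : ℝ → ℝ) (hsmooth : ContDiff ℝ (⊤ : ℕ∞) ρ)
    (hsupp : HasCompactSupport ρ) (hrange : ∀ x, ρ x ∈ Set.Icc (0 : ℝ) 1) :
    ∃ C : ℝ, ∀ L' : ℝ, 1 ≤ L' → ∀ β : ℝ,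
      ‖∑' n : ℤ, (ρ (n / L') : ℂ) * eC (β * n)‖ ≤
        C / L' + C / (L' * distNearestInt β ^ 2 + 1 / L') := by
  obtain ⟨K, hK⟩ : ∃ K, LipschitzWith K (deriv ρ) := by
    have hd : ContDiff ℝ 1 (deriv ρ) :=
      ((contDiff_succ_iff_deriv (n := 1)).mp (hsmooth.of_le (WithTop.coe_le_coe.mpr le_top))).2.2
    exact hd.lipschitzWith_of_hasCompactSupport hsupp.deriv one_ne_zero
  have hdiff : Differentiable ℝ ρ := hsmooth.differentiable (by simp)
  obtain ⟨R, hR0, hR⟩ : ∃ R : ℝ, 0 < R ∧ ∀ x, R ≤ |x| → ρ x = 0 := by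
    simpa [Real.norm_eq_abs] using hsupp.exists_pos_le_norm
  refine ⟨(2 * R + 3) + 2 * K * (2 * R + 5), fun L hL β => ?_⟩
  have hL0 : 0 < L := by linarith
  set N := ⌈R * L⌉₊
  have hNle : (N : ℝ) ≤ R * L + 1 := (Nat.ceil_lt_add_one (by positivity)).le
  have hf : ∀ n : ℤ, (N : ℤ) < |n| → (ρ (n / L) : ℂ) = 0 := by
    intro n hn
    have hn' : (N : ℝ) < |(n : ℝ)| := by exact_mod_cast hn
    rw [hR, Complex.ofReal_zero]
    rw [abs_div, abs_of_pos hL0, le_div_iff₀ hL0]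
    exact (Nat.le_ceil _).trans hn'.le
  set S := ∑' n : ℤ, (ρ (n / L) : ℂ) * eC (β * n)
  have htriv : ‖S‖ ≤ (2 * R + 3) * L := by
    have h : ‖S‖ ≤ (2 * N + 1) * 1 := by
      refine norm_tsum_int_le_of_eq_zero_of_lt_abs (fun n hn => by rw [hf n hn, zero_mul])
        fun n => ?_
      rw [norm_mul, norm_eC, mul_one, Complex.norm_real, Real.norm_of_nonneg (hrange _).1]
      exact (hrange _).2
    nlinarith
  have hdecay : 16 * distNearestInt β ^ 2 * ‖S‖ ≤ (2 * R + 5) * L * (2 * K * (1 / L) ^ 2) := by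
    have h : ‖((2 - 2 * Real.cos (2 * Real.pi * β) : ℝ) : ℂ) * S‖ ≤
        (2 * (N + 1 : ℕ) + 1) * (2 * K * (1 / L) ^ 2) := by
      rw [two_sub_two_cos_mul_tsum (f := fun n : ℤ => (ρ (n / L) : ℂ)) β hf]
      refine norm_tsum_int_le_of_eq_zero_of_lt_abs (fun n hn => ?_) fun n => ?_
      · rw [hf n (by grind), hf (n - 1) (by grind), hf (n + 1) (by grind)]
        simp
      · rw [norm_mul, norm_eC, mul_one]
        have h2 := abs_second_difference_le_s7 hdiff hK (n / L) (h := 1 / L) (by positivity)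
        rw [← sub_div, ← add_div] at h2
        push_cast
        exact_mod_cast h2
    rw [norm_mul, Complex.norm_real] at h
    calc 16 * distNearestInt β ^ 2 * ‖S‖
        ≤ ‖2 - 2 * Real.cos (2 * Real.pi * β)‖ * ‖S‖ := by
          gcongr
          exact (sixteen_mul_distNearestInt_sq_le β).trans (le_abs_self _)
      _ ≤ _ := h
      _ ≤ _ := by
          gcongr
          push_cast
          nlinarith
  have hC : 0 ≤ (2 * R + 3) + 2 * K * (2 * R + 5) := by positivity
  refine le_add_of_nonneg_of_le (by positivity) ?_
  rw [le_div_iff₀ (by positivity)]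
  have h1 : ‖S‖ * (1 / L) ≤ 2 * R + 3 := by
    rw [mul_one_div, div_le_iff₀ hL0]
    exact htriv
  have h2 : L * (16 * distNearestInt β ^ 2 * ‖S‖) ≤ 2 * K * (2 * R + 5) := by
    refine (mul_le_mul_of_nonneg_left hdecay hL0.le).trans_eq ?_
    field_simp
  have h3 : 0 ≤ L * (distNearestInt β ^ 2 * ‖S‖) := by positivity
  linarith
end
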